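/- Let δ, ε > 0 satisfy: δ < j_{1,1} − j_{0,1}; ε < |J₀(j_{1,2})|; ε ≤ (1/√2)·(δ/(1+δ))·√(1 − δ²/j_{0,1}²)·inf_{|r − j_{0,1}| < δ} |J₀'(r)|; and ε ≤ (1/√2)·(δ/(1+δ))·√(1 − δ²/j_{0,2}²)·inf_{|r − j_{0,2}| < δ} |J₀'(r)|. For i = 1, 2 let [a_i, b_i] be the connected component of {r > 0 : |J₀(r)| ≤ ε} containing j_{0,i}, and let a₃ be the infimum of the connected component containing j_{0,3}. Assume further: δ < min(a₂ − j_{0,1}, j_{0,2} − b₁, a₃ − j_{0,2}); b₁² − a₁² < j_{0,1}²; and b₂² − a₂² < j_{0,1}². Let A be the closed annulus {x ∈ ℝ² : j_{0,1} − δ ≤ |x| ≤ j_{0,2} + δ}. Let F : ℝ² → ℝ be a smooth function with ΔF + F = 0 for which 0 is a regular value, and suppose ‖F − J₀(|·|)‖_A < ε. Then there is a connected component U of the open set {x ∈ ℝ² : F(x) ≠ 0} contained in the open annulus {a₁ < |x| < b₂}, whose topological boundary is contained in {a₁ < |x| < b₁} ∪ {a₂ < |x| < b₂}, and such that ℝ²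 \ U has exactly two connected components (that is, U is a nodal domain of connectivity 1). -/

import Mathlib

open Metric RealInnerProductSpace intervalIntegral

/-- The Bessel function of the first kind of integer order `n`:
`J_n(s) = (1/π) ∫₀^π cos (n θ - s sin θ) dθ`. -/
noncomputable def besselJ (n : ℕ) (s : ℝ) : ℝ :=
  (1 / Real.pi) * ∫ θ in (0:ℝ)..Real.pi, Real.cos (n * θ - s * Real.sin θ)

/-- `besselJZero n k` is the `k`-th smallest positive zero of `J_n` (with the
convention `besselJZero n 0 = 0`). -/
noncomputable def besselJZero (n : ℕ) : ℕ → ℝ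
  | 0 => 0
  | k + 1 => sInf {r : ℝ | besselJZero n k < r ∧ besselJ n r = 0}

/-- Rotation of a point of the plane by a right angle. -/
noncomputable def rotate90 (x : EuclideanSpace ℝ (Fin 2)) : EuclideanSpace ℝ (Fin 2) :=
  (WithLp.equiv 2 (Fin 2 → ℝ)).symm ![-(x 1), x 0]

/-- The polar `C¹` norm `‖u‖_A = sup_{x ∈ A} max (|u x|, |∂u/∂r|, |(1/r) ∂u/∂θ|)`. -/
noncomputable def polarC1Norm (A : Set (EuclideanSpace ℝ (Fin 2)))
    (u : EuclideanSpace ℝ (Fin 2) → ℝ) : ℝ :=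
  ⨆ x : A, max |u x| (max
    |⟪gradient u x, ‖(x : EuclideanSpace ℝ (Fin 2))‖⁻¹ • (x : EuclideanSpace ℝ (Fin 2))⟫|
    |⟪gradient u x, ‖(x : EuclideanSpace ℝ (Fin 2))‖⁻¹ • rotate90 (x : EuclideanSpace ℝ (Fin 2))⟫|)

/-- The Euclidean Laplacian of a function on the plane. -/
noncomputable def laplacian (f : EuclideanSpace ℝ (Fin 2) → ℝ)
    (x : EuclideanSpace ℝ (Fin 2)) : ℝ :=
  ∑ i : Fin 2, fderiv ℝ (fun y => fderiv ℝ f y (EuclideanSpace.single i 1)) x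
    (EuclideanSpace.single i 1)

/-- The set of connected components of a set `s`. -/
def componentsOf (s : Set (EuclideanSpace ℝ (Fin 2))) :
    Set (Set (EuclideanSpace ℝ (Fin 2))) :=
  {C | ∃ y ∈ s, C = connectedComponentIn s y}

abbrev Plane := EuclideanSpace ℝ (Fin 2)

/-! ### Topology -/

lemma annulus_preconnected (I : Set ℝ) (hI : I.OrdConnected) (hpos : ∀ r ∈ I, 0 < r) :
    IsPreconnected {x : Plane | ‖x‖ ∈ I} := by
  have h1 : IsPreconnected (sphere (0 : Plane) 1) := by
    apply isPreconnected_sphere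
    rw [← Module.finrank_eq_rank]
    simp
  have h2 : IsPreconnected I := hI.isPreconnected
  have h3 := (h2.prod h1).image (fun p : ℝ × Plane => p.1 • p.2) (by fun_prop)
  convert h3 using 1
  ext x
  simp only [Set.mem_ofPred_eq, Set.mem_image, Set.mem_prod, mem_sphere_iff_norm, sub_zero,
    Prod.exists]
  constructor
  · intro hx
    have h0 := hpos _ hx
    refine ⟨‖x‖, ‖x‖⁻¹ • x, ⟨hx, ?_⟩, ?_⟩
    · rw [norm_smul, norm_inv, norm_norm, inv_mul_cancel₀ h0.ne']
    · rw [smul_smul, mul_inv_cancel₀ h0.ne', one_smul]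
  · rintro ⟨r, w, ⟨hr, hw⟩, rfl⟩
    rw [norm_smul, hw, mul_one, Real.norm_of_nonneg (hpos r hr).le]
    exact hr

lemma preconnected_of_core {S C : Set Plane} (hC : IsPreconnected C) (hCS : C ⊆ S)
    (hne : C.Nonempty)
    (h : ∀ x ∈ S, x ∈ C ∨ ∃ p q : ℝ, p ≤ ‖x‖ ∧ ‖x‖ ≤ q ∧ 0 < ‖x‖ ∧
      (∃ r ∈ Set.Icc p q, r • (‖x‖⁻¹ • x) ∈ C) ∧
      ∀ r ∈ Set.Icc p q, r • (‖x‖⁻¹ • x) ∈ S) : IsPreconnected S := by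
  obtain ⟨c, hc⟩ := hne
  apply isPreconnected_of_forall c
  intro y hy
  rcases h y hy with h | ⟨p, q, hp, hq, h0, ⟨r, hr, hrC⟩, hS⟩
  · exact ⟨C, hCS, hc, h, hC⟩
  · have hT : IsPreconnected ((fun r : ℝ => r • (‖y‖⁻¹ • y)) '' Set.Icc p q) :=
      isPreconnected_Icc.image _ (by fun_prop)
    refine ⟨C ∪ (fun r : ℝ => r • (‖y‖⁻¹ • y)) '' Set.Icc p q, ?_, Or.inl hc, Or.inr ?_, ?_⟩
    · apply Set.union_subset hCS
      rintro _ ⟨s, hs, rfl⟩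
      exact hS s hs
    · refine ⟨‖y‖, ⟨hp, hq⟩, ?_⟩
      simp only [smul_smul, mul_inv_cancel₀ h0.ne', one_smul]
    · exact hC.union _ hrC ⟨r, hr, rfl⟩ hT

lemma norm_ray {x : Plane} (h : 0 < ‖x‖) {r : ℝ} (hr : 0 ≤ r) : ‖r • (‖x‖⁻¹ • x)‖ = r := by
  rw [norm_smul, norm_smul, norm_inv, norm_norm, inv_mul_cancel₀ h.ne', mul_one,
    Real.norm_of_nonneg hr]

lemma unit_ray {x : Plane} (h : 0 < ‖x‖) : ‖(‖x‖⁻¹ • x)‖ = 1 := by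
  rw [norm_smul, norm_inv, norm_norm, inv_mul_cancel₀ h.ne']

lemma self_ray {x : Plane} (h : 0 < ‖x‖) : ‖x‖ • (‖x‖⁻¹ • x) = x := by
  rw [smul_smul, mul_inv_cancel₀ h.ne', one_smul]

lemma exists_norm_eq_plane {r : ℝ} (hr : 0 ≤ r) : ∃ x : Plane, ‖x‖ = r :=
  ⟨EuclideanSpace.single 0 r, by simp [abs_of_nonneg hr]⟩

lemma topo (F : Plane → ℝ) (hF : Continuous F) {a₁ b₁ a₂ b₂ : ℝ}
    (h0 : 0 < a₁) (h01 : a₁ < b₁) (h12 : b₁ < a₂) (h23 : a₂ < b₂)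
    (hmid : ∀ x : Plane, b₁ ≤ ‖x‖ → ‖x‖ ≤ a₂ → F x < 0)
    (h1 : ∀ x : Plane, ‖x‖ = a₁ → 0 < F x) (h2 : ∀ x : Plane, ‖x‖ = b₂ → 0 < F x)
    (m1 : ∀ w : Plane, ‖w‖ = 1 → AntitoneOn (fun r : ℝ => F (r • w)) (Set.Icc a₁ b₁))
    (m2 : ∀ w : Plane, ‖w‖ = 1 → MonotoneOn (fun r : ℝ => F (r • w)) (Set.Icc a₂ b₂)) :
    ∃ x₀, F x₀ ≠ 0 ∧
      connectedComponentIn {x | F x ≠ 0} x₀ ⊆ {x | a₁ < ‖x‖ ∧ ‖x‖ < b₂} ∧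
      frontier (connectedComponentIn {x | F x ≠ 0} x₀)
        ⊆ {x | a₁ < ‖x‖ ∧ ‖x‖ < b₁} ∪ {x | a₂ < ‖x‖ ∧ ‖x‖ < b₂} ∧
      (componentsOf (connectedComponentIn {x | F x ≠ 0} x₀)ᶜ).ncard = 2 := by
  obtain ⟨x₀, hx₀⟩ := exists_norm_eq_plane (h0.le.trans h01.le)
  have hFx₀ : F x₀ < 0 := hmid x₀ hx₀.ge (by linarith)
  set V : Set Plane := {x | (a₁ < ‖x‖ ∧ ‖x‖ < b₂) ∧ F x < 0} with hV
  have hx₀V : x₀ ∈ V := ⟨⟨by linarith, by linarith⟩, hFx₀⟩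
  have hVo : IsOpen V :=
    ((isOpen_lt continuous_const continuous_norm).inter
      (isOpen_lt continuous_norm continuous_const)).inter (isOpen_lt hF continuous_const)
  have hVconn : IsPreconnected V := by
    apply preconnected_of_core (C := {x : Plane | ‖x‖ ∈ Set.Icc b₁ a₂})
      (annulus_preconnected _ Set.ordConnected_Icc (fun r hr => by linarith [hr.1]))
    · intro x hx
      exact ⟨⟨by linarith [hx.1], by linarith [hx.2]⟩, hmid x hx.1 hx.2⟩
    · exact ⟨x₀, by simp only [Set.mem_ofPred_eq, hx₀]; exact ⟨le_rfl, h12.le⟩⟩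
    · rintro x ⟨⟨hx1, hx2⟩, hx3⟩
      have hxp : 0 < ‖x‖ := by linarith
      rcases lt_or_ge ‖x‖ b₁ with hb | hb
      · right
        refine ⟨‖x‖, b₁, le_rfl, hb.le, hxp, ⟨b₁, ⟨hb.le, le_rfl⟩, ?_⟩, ?_⟩
        · simp only [Set.mem_ofPred_eq]
          rw [norm_ray hxp (by linarith)]
          exact ⟨le_rfl, h12.le⟩
        · intro r hr
          refine ⟨?_, ?_⟩
          · rw [norm_ray hxp (by linarith [hr.1])]
            exact ⟨by linarith [hr.1], by linarith [hr.2]⟩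
          · have := m1 _ (unit_ray hxp) (a := ‖x‖) (b := r) ⟨hx1.le, hb.le⟩
              ⟨by linarith [hr.1], hr.2⟩ hr.1
            simp only [self_ray hxp] at this
            linarith
      · rcases le_or_gt ‖x‖ a₂ with ha | ha
        · left; exact ⟨hb, ha⟩
        · right
          refine ⟨a₂, ‖x‖, ha.le, le_rfl, hxp, ⟨a₂, ⟨le_rfl, ha.le⟩, ?_⟩, ?_⟩
          · simp only [Set.mem_ofPred_eq]
            rw [norm_ray hxp (by linarith)]
            exact ⟨h12.le, le_rfl⟩
          · intro r hr
            refine ⟨?_, ?_⟩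
            · rw [norm_ray hxp (by linarith [hr.1])]
              exact ⟨by linarith [hr.1], by linarith [hr.2]⟩
            · have := m2 _ (unit_ray hxp) (a := r) (b := ‖x‖) 
                ⟨hr.1, by linarith [hr.2]⟩ ⟨ha.le, hx2.le⟩ hr.2
              simp only [self_ray hxp] at this
              linarith
  have hUV : connectedComponentIn {x | F x ≠ 0} x₀ = V := by
    apply Set.Subset.antisymm
    · set U := connectedComponentIn {x | F x ≠ 0} x₀
      have hUc : IsPreconnected U := isPreconnected_connectedComponentIn
      have hx₀U : x₀ ∈ U := mem_connectedComponentIn hFx₀.ne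
      have hUF : ∀ x ∈ U, F x ≠ 0 := fun x hx => connectedComponentIn_subset _ _ hx
      have hneg : ∀ x ∈ U, F x < 0 := by
        intro x hx
        by_contra hcon
        push Not at hcon
        obtain ⟨z, hz, hz0⟩ := hUc.intermediate_value hx₀U hx hF.continuousOn
          (show (0:ℝ) ∈ Set.Icc (F x₀) (F x) from ⟨hFx₀.le, hcon⟩)
        exact hUF z hz hz0
      intro x hx
      refine ⟨⟨?_, ?_⟩, hneg x hx⟩
      · by_contra hcon
        push Not at hcon
        obtain ⟨z, hz, hz0⟩ := hUc.intermediate_value hx hx₀U continuous_norm.continuousOn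
          (show a₁ ∈ Set.Icc ‖x‖ ‖x₀‖ from ⟨hcon, by linarith⟩)
        linarith [hneg z hz, h1 z hz0]
      · by_contra hcon
        push Not at hcon
        obtain ⟨z, hz, hz0⟩ := hUc.intermediate_value hx₀U hx continuous_norm.continuousOn
          (show b₂ ∈ Set.Icc ‖x₀‖ ‖x‖ from ⟨by linarith, hcon⟩)
        linarith [hneg z hz, h2 z hz0]
    · exact hVconn.subset_connectedComponentIn hx₀V (fun x hx => hx.2.ne)
  refine ⟨x₀, hFx₀.ne, ?_, ?_, ?_⟩
  · rw [hUV]; exact fun x hx => hx.1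
  · rw [hUV]
    intro x hx
    have hcl : x ∈ {x : Plane | (a₁ ≤ ‖x‖ ∧ ‖x‖ ≤ b₂) ∧ F x ≤ 0} := by
      have hc : IsClosed {x : Plane | (a₁ ≤ ‖x‖ ∧ ‖x‖ ≤ b₂) ∧ F x ≤ 0} :=
        ((isClosed_le continuous_const continuous_norm).inter
          (isClosed_le continuous_norm continuous_const)).inter (isClosed_le hF continuous_const)
      have hsub : V ⊆ {x : Plane | (a₁ ≤ ‖x‖ ∧ ‖x‖ ≤ b₂) ∧ F x ≤ 0} :=
        fun y hy => ⟨⟨hy.1.1.le, hy.1.2.le⟩, hy.2.le⟩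
      exact closure_minimal hsub hc hx.1
    obtain ⟨⟨hxa, hxb⟩, hx3⟩ := hcl
    have hxa' : a₁ < ‖x‖ := lt_of_le_of_ne hxa (fun h => by linarith [h1 x h.symm])
    have hxb' : ‖x‖ < b₂ := lt_of_le_of_ne hxb (fun h => by linarith [h2 x h])
    have hnV : x ∉ V := by
      have := hx.2
      rwa [hVo.interior_eq] at this
    have hF0 : ¬ F x < 0 := fun h => hnV ⟨⟨hxa', hxb'⟩, h⟩
    rcases lt_or_ge ‖x‖ b₁ with hb | hb
    · left; exact ⟨hxa', hb⟩
    · rcases le_or_gt ‖x‖ a₂ with ha | ha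
      · exact absurd (hmid x hb ha) hF0
      · right; exact ⟨ha, hxb'⟩
  · rw [hUV]
    set K₁ : Set Plane := {x | ‖x‖ < b₁ ∧ x ∉ V} with hK₁
    set K₂ : Set Plane := {x | a₂ < ‖x‖ ∧ x ∉ V} with hK₂
    have hcov : ∀ x ∈ Vᶜ, x ∈ K₁ ∨ x ∈ K₂ := by
      intro x hx
      rcases lt_or_ge ‖x‖ b₁ with hb | hb
      · left; exact ⟨hb, hx⟩
      · rcases le_or_gt ‖x‖ a₂ with ha | ha
        · exact absurd ⟨⟨by linarith, by linarith⟩, hmid x hb ha⟩ hx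
        · right; exact ⟨ha, hx⟩
    have hc1 : IsPreconnected K₁ := by
      apply preconnected_of_core (C := closedBall (0 : Plane) a₁)
        (convex_closedBall _ _).isPreconnected
      · intro x hx
        rw [mem_closedBall_zero_iff] at hx
        exact ⟨by linarith, fun h => by linarith [h.1.1]⟩
      · exact ⟨0, by simp [h0.le]⟩
      · rintro x ⟨hx1, hx2⟩
        rcases le_or_gt ‖x‖ a₁ with ha | ha
        · left; simpa using ha
        right
        have hxp : 0 < ‖x‖ := by linarith
        have hFx : 0 ≤ F x := by
          by_contra hcon
          exact hx2 ⟨⟨ha, by linarith⟩, not_le.1 hcon⟩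
        refine ⟨a₁, ‖x‖, ha.le, le_rfl, hxp, ⟨a₁, ⟨le_rfl, ha.le⟩, ?_⟩, ?_⟩
        · rw [mem_closedBall_zero_iff, norm_ray hxp h0.le]
        · intro r hr
          refine ⟨?_, ?_⟩
          · rw [norm_ray hxp (by linarith [hr.1])]
            linarith [hr.2]
          · intro hv
            have := m1 _ (unit_ray hxp) (a := r) (b := ‖x‖) 
              ⟨hr.1, by linarith [hr.2]⟩ ⟨ha.le, hx1.le⟩ hr.2
            simp only [self_ray hxp] at this
            linarith [hv.2]
    have hc2 : IsPreconnected K₂ := by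
      apply preconnected_of_core (C := {x : Plane | ‖x‖ ∈ Set.Ici b₂})
        (annulus_preconnected _ Set.ordConnected_Ici (fun r hr => by
          rw [Set.mem_Ici] at hr; linarith))
      · intro x hx
        simp only [Set.mem_ofPred_eq, Set.mem_Ici] at hx
        exact ⟨by linarith, fun h => by linarith [h.1.2]⟩
      · obtain ⟨y, hy⟩ := exists_norm_eq_plane (r := b₂) (by linarith)
        exact ⟨y, hy.ge⟩
      · rintro x ⟨hx1, hx2⟩
        rcases le_or_gt b₂ ‖x‖ with hb | hb
        · left; exact hb
        right
        have hxp : 0 < ‖x‖ := by linarith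
        have hFx : 0 ≤ F x := by
          by_contra hcon
          exact hx2 ⟨⟨by linarith, hb⟩, not_le.1 hcon⟩
        refine ⟨‖x‖, b₂, le_rfl, hb.le, hxp, ⟨b₂, ⟨hb.le, le_rfl⟩, ?_⟩, ?_⟩
        · simp only [Set.mem_ofPred_eq]
          rw [norm_ray hxp (by linarith)]
          exact Set.mem_Ici.2 le_rfl
        · intro r hr
          refine ⟨?_, ?_⟩
          · rw [norm_ray hxp (by linarith [hr.1])]
            linarith [hr.1]
          · intro hv
            have := m2 _ (unit_ray hxp) (a := ‖x‖) (b := r) ⟨hx1.le, hb.le⟩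
              ⟨by linarith [hr.1], hr.2⟩ hr.1
            simp only [self_ray hxp] at this
            linarith [hv.2]
    have hsep : ∀ C : Set Plane, IsPreconnected C → C ⊆ Vᶜ → ∀ x ∈ C, ∀ y ∈ C,
        x ∈ K₁ → y ∉ K₂ := by
      intro C hC hCV x hx y hy hxK hyK
      obtain ⟨z, hz, hz0⟩ := hC.intermediate_value hx hy continuous_norm.continuousOn
        (show b₁ ∈ Set.Icc ‖x‖ ‖y‖ from ⟨hxK.1.le, by linarith [hyK.1]⟩)
      simp only at hz0
      exact hCV hz ⟨⟨by linarith, by linarith⟩, hmid z hz0.ge (by linarith)⟩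
    have hs1 : K₁ ⊆ Vᶜ := fun x hx => hx.2
    have hs2 : K₂ ⊆ Vᶜ := fun x hx => hx.2
    have e1 : ∀ y ∈ K₁, connectedComponentIn Vᶜ y = K₁ := by
      intro y hy
      apply Set.Subset.antisymm
      · intro z hz
        rcases hcov z (connectedComponentIn_subset _ _ hz) with h | h
        · exact h
        · exact absurd h (hsep _ isPreconnected_connectedComponentIn
            (connectedComponentIn_subset _ _) y (mem_connectedComponentIn (hs1 hy)) z hz hy)
      · exact hc1.subset_connectedComponentIn hy hs1
    have e2 : ∀ y ∈ K₂, connectedComponentIn Vᶜ y = K₂ := by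
      intro y hy
      apply Set.Subset.antisymm
      · intro z hz
        rcases hcov z (connectedComponentIn_subset _ _ hz) with h | h
        · exact absurd hy (hsep _ isPreconnected_connectedComponentIn
            (connectedComponentIn_subset _ _) z hz y (mem_connectedComponentIn (hs2 hy)) h)
        · exact h
      · exact hc2.subset_connectedComponentIn hy hs2
    have z1 : (0 : Plane) ∈ K₁ :=
      ⟨by rw [norm_zero]; linarith, fun h => by have := h.1.1; rw [norm_zero] at this; linarith⟩
    obtain ⟨y, hy⟩ := exists_norm_eq_plane (r := b₂) (by linarith)
    have z2 : y ∈ K₂ := ⟨by linarith, fun h => by linarith [h.1.2]⟩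
    have hcomp : componentsOf Vᶜ = {K₁, K₂} := by
      ext C
      simp only [componentsOf, Set.mem_ofPred_eq, Set.mem_insert_iff, Set.mem_singleton_iff]
      constructor
      · rintro ⟨x, hx, rfl⟩
        rcases hcov x hx with h | h
        · left; exact e1 x h
        · right; exact e2 x h
      · rintro (rfl | rfl)
        · exact ⟨0, hs1 z1, (e1 0 z1).symm⟩
        · exact ⟨y, hs2 z2, (e2 y z2).symm⟩
    rw [hcomp]
    apply Set.ncard_pair
    intro h
    have : (0 : Plane) ∈ K₂ := h ▸ z1
    have := this.1
    rw [norm_zero] at this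
    linarith

/-! ### One-variable facts -/

lemma near_zero (f : ℝ → ℝ) {j δ ε q : ℝ} (hδ : 0 < δ) (hε : 0 < ε) (hq0 : 0 ≤ q) (hq1 : q ≤ 1)
    (h : ε ≤ (1 / Real.sqrt 2) * (δ / (1 + δ)) * q *
      (⨅ r : {r : ℝ // |r - j| < δ}, |deriv f r|)) :
    ∃ m t : ℝ, 0 < m ∧ 0 < t ∧ t < δ ∧ ε < m * t ∧ ε ≤ m ∧ 0 < q ∧
      ∀ r, |r - j| < δ → m ≤ |deriv f r| := by
  set m := ⨅ r : {r : ℝ // |r - j| < δ}, |deriv f r| with hm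
  have hbd : BddBelow (Set.range fun r : {r : ℝ // |r - j| < δ} => |deriv f r|) :=
    ⟨0, by rintro _ ⟨r, rfl⟩; positivity⟩
  have hm0 : 0 ≤ m := Real.iInf_nonneg (fun r => abs_nonneg _)
  have hs : (1 / Real.sqrt 2) ≤ 1 := by
    rw [div_le_one (by positivity)]
    exact Real.one_le_sqrt.2 (by norm_num)
  have hs0 : 0 ≤ 1 / Real.sqrt 2 := by positivity
  have hc0 : 0 < δ / (1 + δ) := by positivity
  have hc1 : δ / (1 + δ) < 1 := by rw [div_lt_one (by positivity)]; linarith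
  have hcδ : δ / (1 + δ) < δ := by
    rw [div_lt_iff₀ (by positivity)]; nlinarith
  have hmp : 0 < m := by
    rcases hm0.eq_or_lt with h' | h'
    · rw [← h', mul_zero] at h; linarith
    · exact h'
  have hqp : 0 < q := by
    rcases hq0.eq_or_lt with h' | h'
    · rw [← h', mul_zero, zero_mul] at h; linarith
    · exact h'
  have hle : ε ≤ δ / (1 + δ) * m := by
    refine h.trans ?_
    apply mul_le_mul_of_nonneg_right _ hm0
    calc (1 / Real.sqrt 2) * (δ / (1 + δ)) * q ≤ 1 * (δ / (1 + δ)) * 1 := by gcongr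
      _ = δ / (1 + δ) := by ring
  refine ⟨m, (δ / (1 + δ) + δ) / 2, hmp, by linarith, by linarith, ?_, ?_, hqp, ?_⟩
  · nlinarith
  · nlinarith
  · intro r hr
    exact ciInf_le hbd ⟨r, hr⟩

lemma sign_dichotomy {g : ℝ → ℝ} (hg : Continuous g) {j δ m : ℝ} (hm : 0 < m)
    (h : ∀ r, |r - j| < δ → m ≤ |g r|) :
    (∀ r, |r - j| < δ → m ≤ g r) ∨ (∀ r, |r - j| < δ → m ≤ - g r) := by
  by_contra hcon
  push Not at hcon
  obtain ⟨⟨r, hr, hr'⟩, s, hs, hs'⟩ := hcon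
  have h1 : g r ≤ 0 := by
    by_contra h'
    have := h r hr
    rw [abs_of_pos (not_le.1 h')] at this
    linarith
  have h2 : 0 ≤ g s := by
    by_contra h'
    have := h s hs
    rw [abs_of_neg (not_le.1 h')] at this
    linarith
  have hpre : IsPreconnected (ball j δ) := (convex_ball _ _).isPreconnected
  obtain ⟨z, hz, hz0⟩ := hpre.intermediate_value (show r ∈ ball j δ from hr)
    (show s ∈ ball j δ from hs) hg.continuousOn (show (0:ℝ) ∈ Set.Icc (g r) (g s) from ⟨h1, h2⟩)
  have := h z hz
  rw [hz0, abs_zero] at this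
  linarith

lemma incr_bounds {f g : ℝ → ℝ} (hfg : ∀ s, HasDerivAt f (g s) s) {j δ m : ℝ}
    (hf : f j = 0) (h : ∀ r, |r - j| < δ → m ≤ g r) :
    (∀ t, 0 < t → t < δ → m * t ≤ f (j + t)) ∧ (∀ t, 0 < t → t < δ → f (j - t) ≤ - (m * t)) := by
  have hc : Continuous f := continuous_iff_continuousAt.2 fun s => (hfg s).continuousAt
  constructor
  · intro t ht htδ
    obtain ⟨c, hc1, hc2⟩ := exists_hasDerivAt_eq_slope f g (show j < j + t by linarith)
      hc.continuousOn (fun x _ => hfg x)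
    have := h c (by rw [abs_lt]; constructor <;> linarith [hc1.1, hc1.2])
    rw [hc2, hf, le_div_iff₀ (by linarith)] at this
    linarith
  · intro t ht htδ
    obtain ⟨c, hc1, hc2⟩ := exists_hasDerivAt_eq_slope f g (show j - t < j by linarith)
      hc.continuousOn (fun x _ => hfg x)
    have := h c (by rw [abs_lt]; constructor <;> linarith [hc1.1, hc1.2])
    rw [hc2, hf, le_div_iff₀ (by linarith)] at this
    linarith

lemma comp_bounds {f g : ℝ → ℝ} (hfg : ∀ s, HasDerivAt f (g s) s) {j δ ε m t a b : ℝ}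
    (hj : 0 < j) (hδj : δ ≤ j) (hε : 0 < ε) (hm : 0 < m) (ht : 0 < t) (htδ : t < δ)
    (hεt : ε < m * t)
    (hf : f j = 0) (h : ∀ r, |r - j| < δ → m ≤ g r)
    (hab : connectedComponentIn {r : ℝ | 0 < r ∧ |f r| ≤ ε} j = Set.Icc a b) :
    j - δ < a ∧ a < j ∧ j < b ∧ b < j + δ ∧ f a = -ε ∧ f b = ε := by
  have hc : Continuous f := continuous_iff_continuousAt.2 fun s => (hfg s).continuousAt
  obtain ⟨hb1, hb2⟩ := incr_bounds hfg hf h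
  set S := {r : ℝ | 0 < r ∧ |f r| ≤ ε} with hS
  have hjS : j ∈ S := ⟨hj, by rw [hf, abs_zero]; exact hε.le⟩
  have hjI : j ∈ Set.Icc a b := hab ▸ mem_connectedComponentIn hjS
  have hIS : ∀ r ∈ Set.Icc a b, r ∈ S := fun r hr =>
    connectedComponentIn_subset S j (hab ▸ hr)
  have ha : j - t < a := by
    by_contra hcon
    have := (hIS (j - t) ⟨not_lt.1 hcon, by linarith [hjI.2]⟩).2
    have h2 := hb2 t ht htδ
    rw [abs_le] at this
    linarith [this.1]
  have hb : b < j + t := by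
    by_contra hcon
    have := (hIS (j + t) ⟨by linarith [hjI.1], not_lt.1 hcon⟩).2
    have h2 := hb1 t ht htδ
    rw [abs_le] at this
    linarith [this.2]
  have hext : ∀ a' b' : ℝ, a' ≤ a → b ≤ b' → (∀ r ∈ Set.Icc a' b', r ∈ S) → a' = a ∧ b' = b := by
    intro a' b' h1 h2 h3
    have := isPreconnected_Icc.subset_connectedComponentIn
      (show j ∈ Set.Icc a' b' from ⟨h1.trans hjI.1, hjI.2.trans h2⟩) h3
    rw [hab] at this
    have l := this (show a' ∈ Set.Icc a' b' from ⟨le_rfl, by linarith [hjI.1, hjI.2]⟩)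
    have r := this (show b' ∈ Set.Icc a' b' from ⟨by linarith [hjI.1, hjI.2], le_rfl⟩)
    exact ⟨le_antisymm h1 l.1, le_antisymm r.2 h2⟩
  have ha0 : 0 < a := by linarith
  have haI : a ∈ Set.Icc a b := ⟨le_rfl, hjI.1.trans hjI.2⟩
  have hbI : b ∈ Set.Icc a b := ⟨hjI.1.trans hjI.2, le_rfl⟩
  have hfa : |f a| = ε := by
    by_contra hne
    have hlt : |f a| < ε := lt_of_le_of_ne (hIS a haI).2 hne
    have hev : ∀ᶠ r in nhds a, |f r| < ε := hc.abs.continuousAt.eventually_lt_const hlt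
    obtain ⟨η, hη, hball⟩ := Metric.eventually_nhds_iff.1 hev
    have hmin : 0 < min (η / 2) (a / 2) := by positivity
    have hm1 := min_le_left (η / 2) (a / 2)
    have hm2 := min_le_right (η / 2) (a / 2)
    have := (hext (a - min (η / 2) (a / 2)) b (by linarith) le_rfl (by
      intro r hr
      rcases le_or_gt a r with h' | h'
      · exact hIS r ⟨h', hr.2⟩
      · refine ⟨by linarith [hr.1], (hball ?_).le⟩
        rw [Real.dist_eq, abs_lt]
        constructor <;> linarith [hr.1])).1
    linarith
  have hfb : |f b| = ε := by
    by_contra hne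
    have hlt : |f b| < ε := lt_of_le_of_ne (hIS b hbI).2 hne
    have hev : ∀ᶠ r in nhds b, |f r| < ε := hc.abs.continuousAt.eventually_lt_const hlt
    obtain ⟨η, hη, hball⟩ := Metric.eventually_nhds_iff.1 hev
    have := (hext a (b + η / 2) le_rfl (by linarith) (by
      intro r hr
      rcases le_or_gt r b with h' | h'
      · exact hIS r ⟨hr.1, h'⟩
      · refine ⟨by linarith [hr.1], (hball ?_).le⟩
        rw [Real.dist_eq, abs_lt]
        constructor <;> linarith [hr.2])).2
    linarith
  have haj : a < j := by
    rcases hjI.1.eq_or_lt with h' | h'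
    · rw [h', hf, abs_zero] at hfa; linarith
    · exact h'
  have hbj : j < b := by
    rcases hjI.2.eq_or_lt with h' | h'
    · rw [← h', hf, abs_zero] at hfb; linarith
    · exact h'
  refine ⟨by linarith, haj, hbj, by linarith, ?_, ?_⟩
  · have := hb2 (j - a) (by linarith) (by linarith)
    rw [sub_sub_cancel] at this
    have h' : f a < 0 := by nlinarith
    rw [abs_of_neg h'] at hfa
    linarith
  · have := hb1 (b - j) (by linarith) (by linarith)
    rw [add_sub_cancel] at this
    have h' : 0 < f b := by nlinarith
    rwa [abs_of_pos h'] at hfb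

/-! ### Bessel facts -/

noncomputable def besD (s : ℝ) : ℝ :=
  -((1 / Real.pi) * ∫ θ in (0:ℝ)..Real.pi, Real.sin θ * Real.sin (s * Real.sin θ))

noncomputable def besDD (s : ℝ) : ℝ :=
  -((1 / Real.pi) * ∫ θ in (0:ℝ)..Real.pi, Real.sin θ ^ 2 * Real.cos (s * Real.sin θ))

lemma bes_eq (s : ℝ) : besselJ 0 s = (1 / Real.pi) * ∫ θ in (0:ℝ)..Real.pi,
    Real.cos (s * Real.sin θ) := by
  simp [besselJ]

lemma param_deriv {k k' : ℝ → ℝ → ℝ} (hk : Continuous (Function.uncurry k))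
    (hk' : Continuous (Function.uncurry k'))
    (hd : ∀ s θ, HasDerivAt (fun s => k s θ) (k' s θ) s) (hb : ∀ s θ, |k' s θ| ≤ 1) (s : ℝ) :
    HasDerivAt (fun s => ∫ θ in (0:ℝ)..Real.pi, k s θ) (∫ θ in (0:ℝ)..Real.pi, k' s θ) s := by
  have c : ∀ s, Continuous (k s) := fun s => hk.comp (by fun_prop : Continuous fun θ => (s, θ))
  have c' : ∀ s, Continuous (k' s) := fun s => hk'.comp (by fun_prop : Continuous fun θ => (s, θ))
  refine (intervalIntegral.hasDerivAt_integral_of_dominated_loc_of_deriv_le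
    (bound := fun _ => 1) (s := Set.univ) (x₀ := s) Filter.univ_mem ?_ ?_ ?_ ?_ ?_ ?_).2
  · exact Filter.Eventually.of_forall fun s => (c s).aestronglyMeasurable
  · exact (c s).intervalIntegrable _ _
  · exact (c' s).aestronglyMeasurable
  · exact Filter.Eventually.of_forall fun θ _ x _ => hb x θ
  · exact intervalIntegrable_const
  · exact Filter.Eventually.of_forall fun θ _ x _ => hd x θ

lemma bes_hasDeriv (s : ℝ) : HasDerivAt (besselJ 0) (besD s) s := by
  have h := param_deriv (k := fun s θ => Real.cos (s * Real.sin θ))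
    (k' := fun s θ => -(Real.sin θ * Real.sin (s * Real.sin θ))) (by fun_prop) (by fun_prop)
    (fun s θ => by
      have := ((hasDerivAt_id s).mul_const (Real.sin θ)).cos
      simp only [id] at this
      refine this.congr_deriv ?_
      ring)
    (fun s θ => by
      rw [abs_neg, abs_mul]
      exact mul_le_one₀ (Real.abs_sin_le_one _) (abs_nonneg _) (Real.abs_sin_le_one _)) s
  have h2 := h.const_mul (1 / Real.pi)
  rw [show besselJ 0 = fun s => (1 / Real.pi) * ∫ θ in (0:ℝ)..Real.pi,
    Real.cos (s * Real.sin θ) from funext bes_eq]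
  have e : besD s = (1 / Real.pi) * ∫ θ in (0:ℝ)..Real.pi,
      -(Real.sin θ * Real.sin (s * Real.sin θ)) := by
    rw [intervalIntegral.integral_neg, mul_neg]; rfl
  rw [e]
  exact h2

lemma besD_hasDeriv (s : ℝ) : HasDerivAt besD (besDD s) s := by
  have h := param_deriv (k := fun s θ => Real.sin θ * Real.sin (s * Real.sin θ))
    (k' := fun s θ => Real.sin θ ^ 2 * Real.cos (s * Real.sin θ)) (by fun_prop) (by fun_prop)
    (fun s θ => by
      have := (((hasDerivAt_id s).mul_const (Real.sin θ)).sin).const_mul (Real.sin θ)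
      simp only [id] at this
      refine this.congr_deriv ?_
      ring)
    (fun s θ => by
      rw [abs_mul, abs_pow]
      exact mul_le_one₀ (pow_le_one₀ (abs_nonneg _) (Real.abs_sin_le_one _)) (abs_nonneg _)
        (Real.abs_cos_le_one _)) s
  exact (h.const_mul (1 / Real.pi)).neg

lemma bes_ode (s : ℝ) : s * (besDD s + besselJ 0 s) = - besD s := by
  have hd : ∀ θ : ℝ, HasDerivAt (fun θ => Real.cos θ * Real.sin (s * Real.sin θ))
      (-Real.sin θ * Real.sin (s * Real.sin θ)
        + Real.cos θ * (Real.cos (s * Real.sin θ) * (s * Real.cos θ))) θ := fun θ =>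
    (Real.hasDerivAt_cos θ).mul (((Real.hasDerivAt_sin θ).const_mul s).sin)
  have hi := intervalIntegral.integral_eq_sub_of_hasDerivAt (a := 0) (b := Real.pi)
    (fun θ _ => hd θ) (Continuous.intervalIntegrable (by fun_prop) _ _)
  simp only [Real.sin_pi, Real.sin_zero, mul_zero, sub_zero] at hi
  have e : (fun θ => -Real.sin θ * Real.sin (s * Real.sin θ)
        + Real.cos θ * (Real.cos (s * Real.sin θ) * (s * Real.cos θ)))
      = fun θ => s * Real.cos (s * Real.sin θ) - s * (Real.sin θ ^ 2 * Real.cos (s * Real.sin θ))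
        - Real.sin θ * Real.sin (s * Real.sin θ) := by
    funext θ
    have := Real.sin_sq_add_cos_sq θ
    linear_combination (s * Real.cos (s * Real.sin θ)) * this
  rw [e, intervalIntegral.integral_sub (Continuous.intervalIntegrable (by fun_prop) _ _)
    (Continuous.intervalIntegrable (by fun_prop) _ _),
    intervalIntegral.integral_sub (Continuous.intervalIntegrable (by fun_prop) _ _)
    (Continuous.intervalIntegrable (by fun_prop) _ _), intervalIntegral.integral_const_mul,
    intervalIntegral.integral_const_mul] at hi
  rw [bes_eq, besD, besDD]
  linear_combination (1 / Real.pi) * hi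

lemma bes_zero : besselJ 0 0 = 1 := by
  simp [bes_eq, Real.pi_ne_zero]

lemma besD_zero : besD 0 = 0 := by
  simp [besD]

lemma bes_cont : Continuous (besselJ 0) :=
  continuous_iff_continuousAt.2 fun s => (bes_hasDeriv s).continuousAt

lemma besD_cont : Continuous besD :=
  continuous_iff_continuousAt.2 fun s => (besD_hasDeriv s).continuousAt

lemma bes_deriv : deriv (besselJ 0) = besD := funext fun s => (bes_hasDeriv s).deriv

lemma bes_contDiff : ContDiff ℝ 1 (besselJ 0) :=
  contDiff_one_iff_deriv.2 ⟨fun s => (bes_hasDeriv s).differentiableAt, by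
    rw [bes_deriv]; exact besD_cont⟩

/-- Between two zeros where the function is negative, `J₀` is quasi-convex. -/
lemma bes_quasi {p q c : ℝ} (hp : 0 < p) (hneg : ∀ r, p ≤ r → r ≤ q → besselJ 0 r < 0)
    (h1 : besselJ 0 p ≤ c) (h2 : besselJ 0 q ≤ c) (r : ℝ) (hr1 : p ≤ r) (hr2 : r ≤ q) :
    besselJ 0 r ≤ c := by
  by_contra hcon
  push Not at hcon
  have hpr : p < r := lt_of_le_of_ne hr1 (by rintro rfl; linarith)
  have hrq : r < q := lt_of_le_of_ne hr2 (by rintro rfl; linarith)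
  obtain ⟨c1, hc1, e1⟩ := exists_hasDerivAt_eq_slope (besselJ 0) besD hpr
    bes_cont.continuousOn (fun x _ => bes_hasDeriv x)
  obtain ⟨c2, hc2, e2⟩ := exists_hasDerivAt_eq_slope (besselJ 0) besD hrq
    bes_cont.continuousOn (fun x _ => bes_hasDeriv x)
  have g1 : 0 < besD c1 := by rw [e1]; apply div_pos <;> linarith
  have g2 : besD c2 < 0 := by rw [e2]; apply div_neg_of_neg_of_pos <;> linarith
  have hd : ∀ s, HasDerivAt (fun s => s * besD s) (1 * besD s + s * besDD s) s := fun s =>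
    (hasDerivAt_id s).mul (besD_hasDeriv s)
  obtain ⟨c3, hc3, e3⟩ := exists_hasDerivAt_eq_slope (fun s => s * besD s) _
    (show c1 < c2 by linarith [hc1.2, hc2.1])
    (continuous_id.mul besD_cont).continuousOn (fun x _ => hd x)
  have hc3p : p < c3 := by linarith [hc1.1, hc3.1]
  have hn := hneg c3 hc3p.le (by linarith [hc2.2, hc3.2])
  have : 1 * besD c3 + c3 * besDD c3 = - (c3 * besselJ 0 c3) := by
    linear_combination bes_ode c3
  rw [this] at e3
  have l : 0 < -(c3 * besselJ 0 c3) := by nlinarith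
  rw [e3] at l
  have k1 : 0 < c2 - c1 := by linarith [hc1.2, hc2.1]
  have := (div_pos_iff_of_pos_right k1).1 l
  have k2 : 0 < c1 * besD c1 := mul_pos (by linarith [hc1.1]) g1
  have k3 : c2 * besD c2 < 0 := mul_neg_of_pos_of_neg (by linarith [hc2.1]) g2
  linarith

/-! ### Closeness -/

lemma closeness {p q ε : ℝ} (hp : 0 < p) {F : Plane → ℝ} (hF : ContDiff ℝ (⊤ : ℕ∞) F)
    (hclose : polarC1Norm {x | p ≤ ‖x‖ ∧ ‖x‖ ≤ q} (fun x => F x - besselJ 0 ‖x‖) < ε) :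
    (∀ x : Plane, p ≤ ‖x‖ → ‖x‖ ≤ q → |F x - besselJ 0 ‖x‖| < ε) ∧
    (∀ w : Plane, ‖w‖ = 1 → ∀ r, p ≤ r → r ≤ q →
      ∃ d, |d - besD r| < ε ∧ HasDerivAt (fun r : ℝ => F (r • w)) d r) := by
  set u : Plane → ℝ := fun x => F x - besselJ 0 ‖x‖ with hu
  set A : Set Plane := {x | p ≤ ‖x‖ ∧ ‖x‖ ≤ q} with hA
  have hud : ∀ x : Plane, x ≠ 0 → ContDiffAt ℝ 1 u x := fun x hx =>
    ((hF.of_le (by exact_mod_cast le_top)).contDiffAt).sub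
      (bes_contDiff.contDiffAt.comp x (contDiffAt_norm ℝ hx))
  have hA0 : ∀ x ∈ A, x ≠ 0 := by
    rintro x hx rfl
    have := hx.1
    rw [norm_zero] at this
    linarith
  have hAc : IsCompact A := by
    have : A = closedBall 0 q ∩ {x | p ≤ ‖x‖} := by
      ext x; simp [hA, and_comm]
    rw [this]
    exact (isCompact_closedBall _ _).inter_right (isClosed_le continuous_const continuous_norm)
  have hgc : ContinuousOn (gradient u) A := by
    intro x hx
    apply ContinuousAt.continuousWithinAt
    have : ContinuousAt (fderiv ℝ u) x := (hud x (hA0 x hx)).continuousAt_fderiv (by simp)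
    exact (LinearIsometryEquiv.continuous _).continuousAt.comp this
  have huc : ContinuousOn u A := fun x hx => (hud x (hA0 x hx)).continuousAt.continuousWithinAt
  have hic : ContinuousOn (fun x : Plane => ‖x‖⁻¹) A :=
    continuous_norm.continuousOn.inv₀ fun x hx => norm_ne_zero_iff.2 (hA0 x hx)
  have hrot : Continuous rotate90 := by
    unfold rotate90
    refine (PiLp.continuous_toLp 2 _).comp ?_
    refine continuous_pi fun i => ?_
    fin_cases i <;> simp <;> fun_prop
  set N : Plane → ℝ := fun x => max |u x| (max
    |⟪gradient u x, ‖x‖⁻¹ • x⟫| |⟪gradient u x, ‖x‖⁻¹ • rotate90 x⟫|) with hN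
  have hNc : ContinuousOn N A :=
    huc.abs.sup (((ContinuousOn.inner (𝕜 := ℝ) hgc (hic.smul continuousOn_id)).abs).sup
      ((ContinuousOn.inner (𝕜 := ℝ) hgc (hic.smul hrot.continuousOn)).abs))
  have hbd : BddAbove (Set.range fun x : A => N x) := by
    have := hAc.bddAbove_image hNc
    rwa [Set.image_eq_range] at this
  have hlt : ∀ x ∈ A, N x < ε := fun x hx => lt_of_le_of_lt (le_ciSup hbd ⟨x, hx⟩) hclose
  constructor
  · intro x h1 h2
    exact lt_of_le_of_lt (le_max_left _ _) (hlt x ⟨h1, h2⟩)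
  · intro w hw r hr1 hr2
    have hr : 0 < r := by linarith
    have hn : ‖r • w‖ = r := by rw [norm_smul, hw, mul_one, Real.norm_of_nonneg hr.le]
    have hx : r • w ∈ A := by
      show p ≤ ‖r • w‖ ∧ ‖r • w‖ ≤ q
      rw [hn]; exact ⟨hr1, hr2⟩
    have hgr : HasFDerivAt u (fderiv ℝ u (r • w)) (r • w) :=
      ((hud _ (hA0 _ hx)).differentiableAt (by simp)).hasFDerivAt
    have hline : HasDerivAt (fun r : ℝ => r • w) w r := by
      simpa using (hasDerivAt_id r).smul_const w
    have h1 : HasDerivAt (fun r : ℝ => u (r • w)) (fderiv ℝ u (r • w) w) r :=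
      HasFDerivAt.comp_hasDerivAt (l := u) r hgr hline
    have h2 := h1.add (bes_hasDeriv r)
    refine ⟨fderiv ℝ u (r • w) w + besD r, ?_, ?_⟩
    · have h3 : |⟪gradient u (r • w), ‖r • w‖⁻¹ • (r • w)⟫| < ε :=
        lt_of_le_of_lt ((le_max_left _ _).trans (le_max_right _ _)) (hlt _ hx)
      rw [hn, smul_smul, inv_mul_cancel₀ hr.ne', one_smul] at h3
      have h4 : ⟪gradient u (r • w), w⟫ = fderiv ℝ u (r • w) w := by
        rw [gradient, InnerProductSpace.toDual_symm_apply]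
      rw [h4] at h3
      simpa using h3
    · refine h2.congr_of_eventuallyEq ?_
      filter_upwards [lt_mem_nhds hr] with s hs
      have : ‖s • w‖ = s := by rw [norm_smul, hw, mul_one, Real.norm_of_nonneg hs.le]
      simp [hu, this]

/-- An eigenfunction `F` which is `ε`-close in the polar `C¹` norm to `J₀(|·|)` on the
closed annulus `j₀₁ - δ ≤ |x| ≤ j₀₂ + δ` has a nodal domain of connectivity `1`,
with one boundary component in the annulus `a₁ < |x| < b₁` and the other in
`a₂ < |x| < b₂`. -/
theorem nodal_domain_with_one_hole
    (δ ε : ℝ) (hδ0 : 0 < δ) (hε0 : 0 < ε)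
    (hδ : δ < besselJZero 1 1 - besselJZero 0 1)
    (hε1 : ε < |besselJ 0 (besselJZero 1 2)|)
    (hε2 : ε ≤ (1 / Real.sqrt 2) * (δ / (1 + δ)) *
      Real.sqrt (1 - δ ^ 2 / besselJZero 0 1 ^ 2) *
      (⨅ r : {r : ℝ // |r - besselJZero 0 1| < δ}, |deriv (besselJ 0) r|))
    (hε3 : ε ≤ (1 / Real.sqrt 2) * (δ / (1 + δ)) *
      Real.sqrt (1 - δ ^ 2 / besselJZero 0 2 ^ 2) *
      (⨅ r : {r : ℝ // |r - besselJZero 0 2| < δ}, |deriv (besselJ 0) r|))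
    (a₁ b₁ a₂ b₂ a₃ : ℝ)
    (hab₁ : connectedComponentIn {r : ℝ | 0 < r ∧ |besselJ 0 r| ≤ ε} (besselJZero 0 1)
      = Set.Icc a₁ b₁)
    (hab₂ : connectedComponentIn {r : ℝ | 0 < r ∧ |besselJ 0 r| ≤ ε} (besselJZero 0 2)
      = Set.Icc a₂ b₂)
    (ha₃ : a₃ = sInf (connectedComponentIn {r : ℝ | 0 < r ∧ |besselJ 0 r| ≤ ε}
      (besselJZero 0 3)))
    (hδ' : δ < min (a₂ - besselJZero 0 1) (min (besselJZero 0 2 - b₁) (a₃ - besselJZero 0 2)))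
    (hvol₁ : b₁ ^ 2 - a₁ ^ 2 < besselJZero 0 1 ^ 2)
    (hvol₂ : b₂ ^ 2 - a₂ ^ 2 < besselJZero 0 1 ^ 2)
    (A : Set (EuclideanSpace ℝ (Fin 2)))
    (hA : A = {x | besselJZero 0 1 - δ ≤ ‖x‖ ∧ ‖x‖ ≤ besselJZero 0 2 + δ})
    (F : EuclideanSpace ℝ (Fin 2) → ℝ) (hF : ContDiff ℝ (⊤ : ℕ∞) F)
    (hEq : ∀ x, laplacian F x + F x = 0)
    (hreg : ∀ x, F x = 0 → fderiv ℝ F x ≠ 0)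
    (hclose : polarC1Norm A (fun x => F x - besselJ 0 ‖x‖) < ε) :
    ∃ x₀, F x₀ ≠ 0 ∧
      connectedComponentIn {x | F x ≠ 0} x₀ ⊆ {x | a₁ < ‖x‖ ∧ ‖x‖ < b₂} ∧
      frontier (connectedComponentIn {x | F x ≠ 0} x₀)
        ⊆ {x | a₁ < ‖x‖ ∧ ‖x‖ < b₁} ∪ {x | a₂ < ‖x‖ ∧ ‖x‖ < b₂} ∧
      (componentsOf (connectedComponentIn {x | F x ≠ 0} x₀)ᶜ).ncard = 2 := by
  set j₁ := besselJZero 0 1 with hj₁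
  set j₂ := besselJZero 0 2 with hj₂
  obtain ⟨m₁, t₁, hm₁, ht₁, htδ₁, hεt₁, hεm₁, hq₁, hinf₁⟩ := near_zero (besselJ 0) hδ0 hε0
    (Real.sqrt_nonneg _) (Real.sqrt_le_one.2 (by
      have : 0 ≤ δ ^ 2 / j₁ ^ 2 := by positivity
      linarith)) hε2
  obtain ⟨m₂, t₂, hm₂, ht₂, htδ₂, hεt₂, hεm₂, hq₂, hinf₂⟩ := near_zero (besselJ 0) hδ0 hε0
    (Real.sqrt_nonneg _) (Real.sqrt_le_one.2 (by
      have : 0 ≤ δ ^ 2 / j₂ ^ 2 := by positivity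
      linarith)) hε3
  rw [bes_deriv] at hinf₁ hinf₂
  -- the first zero
  have hj₁def : j₁ = sInf {r : ℝ | 0 < r ∧ besselJ 0 r = 0} := by
    rw [hj₁, besselJZero, besselJZero]
  have hj₂def : j₂ = sInf {r : ℝ | j₁ < r ∧ besselJ 0 r = 0} := by
    rw [hj₂, besselJZero]
  have hj₁0 : j₁ ≠ 0 := by
    intro h
    have := hinf₁ 0 (by rw [h]; simpa using hδ0)
    rw [besD_zero, abs_zero] at this
    linarith
  have hbdd : ∀ c : ℝ, BddBelow {r : ℝ | c < r ∧ besselJ 0 r = 0} := fun c =>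
    ⟨c, fun r hr => hr.1.le⟩
  have hmemcl : ∀ c : ℝ, {r : ℝ | c < r ∧ besselJ 0 r = 0}.Nonempty →
      c ≤ sInf {r : ℝ | c < r ∧ besselJ 0 r = 0} ∧
      besselJ 0 (sInf {r : ℝ | c < r ∧ besselJ 0 r = 0}) = 0 := by
    intro c hne
    have h1 := csInf_mem_closure hne (hbdd c)
    have hcl : IsClosed {r : ℝ | c ≤ r ∧ besselJ 0 r = 0} :=
      (isClosed_le continuous_const continuous_id).inter
        (isClosed_eq bes_cont continuous_const)
    have hsub : {r : ℝ | c < r ∧ besselJ 0 r = 0} ⊆ {r : ℝ | c ≤ r ∧ besselJ 0 r = 0} :=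
      fun r hr => ⟨hr.1.le, hr.2⟩
    exact closure_minimal hsub hcl h1
  have hne₁ : {r : ℝ | 0 < r ∧ besselJ 0 r = 0}.Nonempty := by
    by_contra h
    rw [Set.not_nonempty_iff_eq_empty] at h
    rw [h, Real.sInf_empty] at hj₁def
    exact hj₁0 hj₁def
  obtain ⟨hj₁ge, hfj₁⟩ := hmemcl 0 hne₁
  rw [← hj₁def] at hj₁ge hfj₁
  have hj₁pos : 0 < j₁ := lt_of_le_of_ne hj₁ge hj₁0.symm
  have hδj₁ : δ < j₁ := by
    have h := Real.sqrt_pos.1 hq₁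
    have h' : δ ^ 2 / j₁ ^ 2 < 1 := by linarith
    rw [div_lt_one (by positivity)] at h'
    exact lt_of_pow_lt_pow_left₀ 2 hj₁pos.le h'
  have hnz₁ : ∀ r, 0 < r → r < j₁ → besselJ 0 r ≠ 0 := by
    intro r h1 h2 h3
    have := csInf_le (hbdd 0) (show r ∈ {r : ℝ | 0 < r ∧ besselJ 0 r = 0} from ⟨h1, h3⟩)
    rw [← hj₁def] at this
    linarith
  have hdec : ∀ r, |r - j₁| < δ → m₁ ≤ - besD r := by
    rcases sign_dichotomy besD_cont hm₁ hinf₁ with h | h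
    · exfalso
      have := (incr_bounds bes_hasDeriv hfj₁ h).2 t₁ ht₁ htδ₁
      obtain ⟨z, hz, hz0⟩ := intermediate_value_Icc' (show (0:ℝ) ≤ j₁ - t₁ by linarith)
        bes_cont.continuousOn (show (0:ℝ) ∈ Set.Icc (besselJ 0 (j₁ - t₁)) (besselJ 0 0) from
          ⟨by linarith, by rw [bes_zero]; norm_num⟩)
      have hzne : z ≠ 0 := by rintro rfl; rw [bes_zero] at hz0; norm_num at hz0
      exact hnz₁ z (lt_of_le_of_ne hz.1 hzne.symm) (by linarith [hz.2]) hz0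
    · exact h
  have hneg_deriv : ∀ s, HasDerivAt (fun r => - besselJ 0 r) (- besD s) s := fun s =>
    (bes_hasDeriv s).neg
  obtain ⟨k1, k2, k3, k4, k5, k6⟩ := comp_bounds hneg_deriv hj₁pos hδj₁.le hε0 hm₁ ht₁ htδ₁ hεt₁
    (by rw [hfj₁, neg_zero]) hdec (a := a₁) (b := b₁) (by simpa only [abs_neg] using hab₁)
  have hδ1 : δ < a₂ - j₁ := hδ'.trans_le (min_le_left _ _)
  have hδ2 : δ < j₂ - b₁ := hδ'.trans_le ((min_le_right _ _).trans (min_le_left _ _))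
  have hj₁₂ : j₁ < j₂ := by linarith
  have hne₂ : {r : ℝ | j₁ < r ∧ besselJ 0 r = 0}.Nonempty := by
    by_contra h
    rw [Set.not_nonempty_iff_eq_empty] at h
    rw [h, Real.sInf_empty] at hj₂def
    linarith
  obtain ⟨-, hfj₂⟩ := hmemcl j₁ hne₂
  rw [← hj₂def] at hfj₂
  have hnz₂ : ∀ r, j₁ < r → r < j₂ → besselJ 0 r ≠ 0 := by
    intro r h1 h2 h3
    have := csInf_le (hbdd j₁) (show r ∈ {r : ℝ | j₁ < r ∧ besselJ 0 r = 0} from ⟨h1, h3⟩)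
    rw [← hj₂def] at this
    linarith
  have hneg : ∀ r, j₁ < r → r < j₂ → besselJ 0 r < 0 := by
    intro r h1 h2
    by_contra hcon
    push Not at hcon
    have hpre : IsPreconnected (Set.Ioo j₁ j₂) := isPreconnected_Ioo
    obtain ⟨z, hz, hz0⟩ := hpre.intermediate_value (show b₁ ∈ Set.Ioo j₁ j₂ from ⟨k3, by linarith⟩)
      (show r ∈ Set.Ioo j₁ j₂ from ⟨h1, h2⟩) bes_cont.continuousOn
      (show (0:ℝ) ∈ Set.Icc (besselJ 0 b₁) (besselJ 0 r) from ⟨by linarith, hcon⟩)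
    exact hnz₂ z hz.1 hz.2 hz0
  have hinc : ∀ r, |r - j₂| < δ → m₂ ≤ besD r := by
    rcases sign_dichotomy besD_cont hm₂ hinf₂ with h | h
    · exact h
    · exfalso
      have := (incr_bounds hneg_deriv (by rw [hfj₂, neg_zero]) h).2 t₂ ht₂ htδ₂
      have h' := hneg (j₂ - t₂) (by linarith) (by linarith)
      nlinarith
  obtain ⟨l1, l2, l3, l4, l5, l6⟩ := comp_bounds bes_hasDeriv (by linarith : 0 < j₂)
    (by linarith : δ ≤ j₂) hε0 hm₂ ht₂ htδ₂ hεt₂ hfj₂ hinc hab₂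
  have hb₁a₂ : b₁ < a₂ := by linarith
  rw [hA] at hclose
  obtain ⟨cl1, cl2⟩ := closeness (by linarith : 0 < j₁ - δ) hF hclose
  apply topo F hF.continuous (by linarith) (by linarith) hb₁a₂ (by linarith)
  · intro x h1 h2
    have h3 := cl1 x (by linarith) (by linarith)
    have h4 := bes_quasi (p := b₁) (q := a₂) (c := -ε) (by linarith)
      (fun r hr1 hr2 => hneg r (by linarith) (by linarith)) (by linarith) l5.le ‖x‖ h1 h2
    rw [abs_lt] at h3
    linarith [h3.2]
  · intro x h1
    have h3 := cl1 x (by linarith) (by linarith)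
    rw [h1, abs_lt] at h3
    linarith [h3.1]
  · intro x h1
    have h3 := cl1 x (by linarith) (by linarith)
    rw [h1, abs_lt] at h3
    linarith [h3.1]
  · intro w hw
    have hd : ∀ r ∈ Set.Icc a₁ b₁, ∃ d ≤ 0, HasDerivAt (fun r : ℝ => F (r • w)) d r := by
      intro r hr
      obtain ⟨d, hd1, hd2⟩ := cl2 w hw r (by linarith [hr.1]) (by linarith [hr.2])
      refine ⟨d, ?_, hd2⟩
      have := hdec r (by rw [abs_lt]; constructor <;> linarith [hr.1, hr.2])
      rw [abs_lt] at hd1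
      linarith [hd1.2]
    apply antitoneOn_of_deriv_nonpos (convex_Icc _ _)
    · intro r hr
      obtain ⟨d, _, hd2⟩ := hd r hr
      exact hd2.continuousAt.continuousWithinAt
    · intro r hr
      obtain ⟨d, _, hd2⟩ := hd r (interior_subset hr)
      exact hd2.differentiableAt.differentiableWithinAt
    · intro r hr
      obtain ⟨d, hd1, hd2⟩ := hd r (interior_subset hr)
      rw [hd2.deriv]; exact hd1
  · intro w hw
    have hd : ∀ r ∈ Set.Icc a₂ b₂, ∃ d, 0 ≤ d ∧ HasDerivAt (fun r : ℝ => F (r • w)) d r := by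
      intro r hr
      obtain ⟨d, hd1, hd2⟩ := cl2 w hw r (by linarith [hr.1]) (by linarith [hr.2])
      refine ⟨d, ?_, hd2⟩
      have := hinc r (by rw [abs_lt]; constructor <;> linarith [hr.1, hr.2])
      rw [abs_lt] at hd1
      linarith [hd1.1]
    apply monotoneOn_of_deriv_nonneg (convex_Icc _ _)
    · intro r hr
      obtain ⟨d, _, hd2⟩ := hd r hr
      exact hd2.continuousAt.continuousWithinAt
    · intro r hr
      obtain ⟨d, _, hd2⟩ := hd r (interior_subset hr)
      exact hd2.differentiableAt.differentiableWithinAt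
    · intro r hr
      obtain ⟨d, hd1, hd2⟩ := hd r (interior_subset hr)
      rw [hd2.deriv]; exact hd1
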